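/- Let n be a positive even integer, let k ≥ ℓ ≥ 0 be integers with k−ℓ even, and set λ = −ρ−1/2−k, ν = −ρ_H−1/2−ℓ. Then the complex vector space V^{+1}(λ,ν) is two-dimensional. -/

import Mathlib

/-- Extension of `s : ℕ×ℕ → ℂ` to integer indices, with the convention that `s(i,j) = 0`
whenever `i < 0`, `j < 0` or `j > i`. -/
noncomputable def extS (s : ℕ × ℕ → ℂ) : ℤ → ℤ → ℂ :=
  fun i j => if 0 ≤ i ∧ 0 ≤ j ∧ j ≤ i then s (i.toNat, j.toNat) else 0

lemma extS_add (a b : ℕ × ℕ → ℂ) (i j : ℤ) :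
    extS (a + b) i j = extS a i j + extS b i j := by
  unfold extS; split <;> simp

lemma extS_smul (r : ℂ) (a : ℕ × ℕ → ℂ) (i j : ℤ) :
    extS (r • a) i j = r * extS a i j := by
  unfold extS; split <;> simp

/-- The space `V^ε(λ,ν)` of functions `s : ℕ×ℕ → ℂ`, vanishing for `j > i`, satisfying the
three relations (R1), (R2), (R3) for all integers `i ≥ j ≥ 0` (with the convention that
`s(i,j) = 0` whenever `i < 0`, `j < 0` or `j > i`).  Here `ρ = n/2` and `ρ_H = (n−1)/2`. -/
noncomputable def Vsp (n : ℕ) (eps lam nu : ℂ) : Submodule ℂ (ℕ × ℕ → ℂ) where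
  carrier := {s | (∀ p : ℕ × ℕ, p.1 < p.2 → s p = 0)
    ∧ (∀ i j : ℕ, j ≤ i →
        ((n : ℂ) + 2 * i - 1) * ((n : ℂ) + 2 * i + 1)
            * (nu + ((n : ℂ) - 1) / 2 + 1 / 2 + j) * s (i, j)
          = ((n : ℂ) + 2 * i - 1) * ((n : ℂ) + 2 * j - 1)
              * (lam + (n : ℂ) / 2 + 1 / 2 + i) * extS s ((i : ℤ) + 1) ((j : ℤ) + 1)
            + eps * (-1 : ℂ) ^ (i - j + 1) * 2 * ((n : ℂ) + 2 * j - 1)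
              * Complex.I * lam * extS s (i : ℤ) ((j : ℤ) + 1)
            - ((n : ℂ) + 2 * i + 1) * ((n : ℂ) + 2 * j - 1)
              * (lam - (n : ℂ) / 2 + 1 / 2 - i) * extS s ((i : ℤ) - 1) ((j : ℤ) + 1))
    ∧ (∀ i j : ℕ, j ≤ i →
        (((n : ℂ) + 2 * i - 1) * ((n : ℂ) + 2 * i + 1) * nu
            - eps * (-1 : ℂ) ^ (i - j) * ((n : ℂ) + 2 * i) * ((n : ℂ) + 2 * j - 1) * lam)
            * s (i, j)
          = -(((i : ℂ) - j + 1)) * ((n : ℂ) + 2 * i - 1) * Complex.I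
              * (lam + (n : ℂ) / 2 + 1 / 2 + i) * extS s ((i : ℤ) + 1) (j : ℤ)
            + ((n : ℂ) + 2 * i + 1) * ((n : ℂ) + i + j - 1) * Complex.I
              * (lam - (n : ℂ) / 2 + 1 / 2 - i) * extS s ((i : ℤ) - 1) (j : ℤ))
    ∧ (∀ i j : ℕ, 1 ≤ j → j ≤ i →
        ((n : ℂ) + 2 * i - 1) * ((n : ℂ) + 2 * i + 1) * ((n : ℂ) + 2 * j - 3)
            * (nu - ((n : ℂ) - 1) / 2 + 1 / 2 - j) * s (i, j)
          = -(((i : ℂ) - j + 1)) * (((i : ℂ) - j + 2)) * ((n : ℂ) + 2 * i - 1)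
              * (lam + (n : ℂ) / 2 + 1 / 2 + i) * extS s ((i : ℤ) + 1) ((j : ℤ) - 1)
            + eps * (-1 : ℂ) ^ (i - j + 1) * 2 * (((i : ℂ) - j + 1)) * ((n : ℂ) + i + j - 1)
              * Complex.I * lam * extS s (i : ℤ) ((j : ℤ) - 1)
            + ((n : ℂ) + 2 * i + 1) * ((n : ℂ) + i + j - 2) * ((n : ℂ) + i + j - 1)
              * (lam - (n : ℂ) / 2 + 1 / 2 - i) * extS s ((i : ℤ) - 1) ((j : ℤ) - 1))}
  add_mem' := by
    rintro a b ⟨ha0, ha1, ha2, ha3⟩ ⟨hb0, hb1, hb2, hb3⟩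
    refine ⟨fun p hp => by simp [Pi.add_apply, ha0 p hp, hb0 p hp], ?_, ?_, ?_⟩
    · intro i j hij
      simp only [Pi.add_apply, extS_add]
      linear_combination ha1 i j hij + hb1 i j hij
    · intro i j hij
      simp only [Pi.add_apply, extS_add]
      linear_combination ha2 i j hij + hb2 i j hij
    · intro i j h1 hij
      simp only [Pi.add_apply, extS_add]
      linear_combination ha3 i j h1 hij + hb3 i j h1 hij
  zero_mem' := by
    refine ⟨fun p _ => rfl, ?_, ?_, ?_⟩ <;>
      · intro i j
        intros
        simp [extS]
  smul_mem' := by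
    rintro r a ⟨ha0, ha1, ha2, ha3⟩
    refine ⟨fun p hp => by simp [Pi.smul_apply, ha0 p hp], ?_, ?_, ?_⟩
    · intro i j hij
      simp only [Pi.smul_apply, smul_eq_mul, extS_smul]
      linear_combination r * ha1 i j hij
    · intro i j hij
      simp only [Pi.smul_apply, smul_eq_mul, extS_smul]
      linear_combination r * ha2 i j hij
    · intro i j h1 hij
      simp only [Pi.smul_apply, smul_eq_mul, extS_smul]
      linear_combination r * ha3 i j h1 hij


/-- (R2) as an expression, after the rescaling `s(i,j) = I^(i+j) t(i,j)`, in the variables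
`p = n+2i`, `q = n+2j`, `L = n+1+2k`, `N = n+2l` -/
noncomputable def E2 (L N p q σ a1 a0 am : ℂ) : ℂ :=
  2 * (-((p^2-1) * N) + σ * p * (q-1) * L) * a0 - (p-q+2) * (p-1) * (p-L+1) * a1
    + (p+1) * (p+q-2) * (p+L-1) * am

/-- (R3) as an expression (rescaled); `b` at level `q`, `a` at level `q-2` -/
noncomputable def E3 (L N p q σ b a1 a0 am : ℂ) : ℂ :=
  4 * (p^2-1) * ((q-3) * (N+q-2)) * b - (p-q+2) * (p-q+4) * (p-1) * (p-L+1) * a1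
    + 2 * σ * (p-q+2) * (p+q-2) * L * a0 + (p+1) * (p+q-4) * (p+q-2) * (p+L-1) * am

/-- (R1) as an expression (rescaled); `b` at level `q`, `a` at level `q+2` -/
noncomputable def E1 (L N p q σ b a1 a0 am : ℂ) : ℂ :=
  (p^2-1) * (q-N) * b + (p-1) * (q-1) * (p-L+1) * a1 + 2 * σ * (q-1) * L * a0
    - (p+1) * (q-1) * (p+L-1) * am

set_option maxHeartbeats 2000000 in
lemma keyA1 (L N p q σ a2 a1 a0 am1 am2 b1 b0 bm : ℂ) (hσ : σ = 1 ∨ σ = -1)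
    (h2p : E2 L N (p+2) (q-2) σ a2 a1 a0 = 0)
    (h20 : E2 L N p (q-2) (-σ) a1 a0 am1 = 0)
    (h2m : E2 L N (p-2) (q-2) σ a0 am1 am2 = 0)
    (h3p : E3 L N (p+2) q (-σ) b1 a2 a1 a0 = 0)
    (h30 : E3 L N p q σ b0 a1 a0 am1 = 0)
    (h3m : E3 L N (p-2) q (-σ) bm a0 am1 am2 = 0) :
    4 * ((p+3) * (p+1) * (p-1) * (p-3)) * ((q-3) * (N+q-2)) * E2 L N p q σ b1 b0 bm = 0 := by
  unfold E2 E3 at *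
  rcases hσ with rfl | rfl
  · linear_combination
      ((p-q+2)*(p-q+4)*(p-1)^2*(p-3)*(p-L+1)) * h2p
      - (2*L*(p-q+2)*(p+q-2)*(p^2-9)) * h20
      - ((p+1)^2*(p+3)*(p+q-2)*(p+q-4)*(p+L-1)) * h2m
      - ((p-q+2)*(p-1)^2*(p-L+1)*(p-3)) * h3p
      + (2*(-((p^2-1) * N) + p * (q-1) * L)*(p^2-9)) * h30
      + ((p+1)^2*(p+q-2)*(p+L-1)*(p+3)) * h3m
  · linear_combination
      ((p-q+2)*(p-q+4)*(p-1)^2*(p-3)*(p-L+1)) * h2p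
      + (2*L*(p-q+2)*(p+q-2)*(p^2-9)) * h20
      - ((p+1)^2*(p+3)*(p+q-2)*(p+q-4)*(p+L-1)) * h2m
      - ((p-q+2)*(p-1)^2*(p-L+1)*(p-3)) * h3p
      + (2*(-((p^2-1) * N) - p * (q-1) * L)*(p^2-9)) * h30
      + ((p+1)^2*(p+q-2)*(p+L-1)*(p+3)) * h3m

set_option maxHeartbeats 2000000 in
lemma keyA2 (L N p q σ a2 a1 a0 am1 am2 b1 b0 bm : ℂ) (hσ : σ = 1 ∨ σ = -1)
    (h2p : E2 L N (p+2) q (-σ) a2 a1 a0 = 0)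
    (h20 : E2 L N p q σ a1 a0 am1 = 0)
    (h2m : E2 L N (p-2) q (-σ) a0 am1 am2 = 0)
    (h3p : E3 L N (p+2) (q+2) σ b1 a2 a1 a0 = 0)
    (h30 : E3 L N p (q+2) (-σ) b0 a1 a0 am1 = 0)
    (h3m : E3 L N (p-2) (q+2) σ bm a0 am1 am2 = 0) :
    4 * ((p+3) * (p+1) * (p-1) * (p-3)) * (N+q) * E1 L N p q σ a0 b1 b0 bm = 0 := by
  unfold E2 E3 E1 at *
  rcases hσ with rfl | rfl
  · linear_combination
      (- ((p-q+2)*(p-1)^2*(p-3)*(p-L+1)) * h2p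
      + 2*(N*(p^2-1) + L*p*(q-1))*(p^2-9) * h20
      + ((p+1)^2*(p+3)*(p+q-2)*(p+L-1)) * h2m)
      + (p-1)^2*(p-L+1)*(p-3) * h3p
      + 2*L*(p^2-9) * h30
      - (p+1)^2*(p+L-1)*(p+3) * h3m
  · linear_combination
      (- ((p-q+2)*(p-1)^2*(p-3)*(p-L+1)) * h2p
      + 2*(N*(p^2-1) - L*p*(q-1))*(p^2-9) * h20
      + ((p+1)^2*(p+3)*(p+q-2)*(p+L-1)) * h2m)
      + (p-1)^2*(p-L+1)*(p-3) * h3p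
      - 2*L*(p^2-9) * h30
      - (p+1)^2*(p+L-1)*(p+3) * h3m

set_option maxHeartbeats 2000000 in
lemma keyB (L N p q σ a2 a1 a0 am1 am2 b1 b0 bm : ℂ) (hσ : σ = 1 ∨ σ = -1)
    (h2p : E2 L N (p+2) (q+2) σ a2 a1 a0 = 0)
    (h20 : E2 L N p (q+2) (-σ) a1 a0 am1 = 0)
    (h2m : E2 L N (p-2) (q+2) σ a0 am1 am2 = 0)
    (h1p : E1 L N (p+2) q (-σ) b1 a2 a1 a0 = 0)
    (h10 : E1 L N p q σ b0 a1 a0 am1 = 0)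
    (h1m : E1 L N (p-2) q (-σ) bm a0 am1 am2 = 0) :
    ((p+3) * (p+1) * (p-1) * (p-3)) * (q-N) * E2 L N p q σ b1 b0 bm = 0 := by
  unfold E2 E1 at *
  rcases hσ with rfl | rfl
  · linear_combination
      (q-1) * (- ((p-1)^2*(p-3)*(p-L+1)) * h2p
      - 2*L*(p^2-9) * h20
      + ((p+1)^2*(p+3)*(p+L-1)) * h2m)
      - ((p-q+2)*(p-1)^2*(p-L+1)*(p-3)) * h1p
      + (2*(-((p^2-1) * N) + p * (q-1) * L)*(p^2-9)) * h10
      + ((p+1)^2*(p+q-2)*(p+L-1)*(p+3)) * h1m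
  · linear_combination
      (q-1) * (- ((p-1)^2*(p-3)*(p-L+1)) * h2p
      + 2*L*(p^2-9) * h20
      + ((p+1)^2*(p+3)*(p+L-1)) * h2m)
      - ((p-q+2)*(p-1)^2*(p-L+1)*(p-3)) * h1p
      + (2*(-((p^2-1) * N) - p * (q-1) * L)*(p^2-9)) * h10
      + ((p+1)^2*(p+q-2)*(p+L-1)*(p+3)) * h1m


/-- parity sign -/
noncomputable def sg (m : ℤ) : ℂ := (-1 : ℂ) ^ m

lemma sg_cases (m : ℤ) : sg m = 1 ∨ sg m = -1 := by
  unfold sg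
  rcases Int.even_or_odd m with h | h
  · left; exact h.neg_one_zpow
  · right; exact h.neg_one_zpow

lemma sg_add_one (m : ℤ) : sg (m + 1) = - sg m := by
  unfold sg
  rw [zpow_add_one₀ (by norm_num)]; ring

lemma sg_sub_one (m : ℤ) : sg (m - 1) = - sg m := by
  have := sg_add_one (m - 1)
  rw [sub_add_cancel] at this
  rw [this]; ring

lemma odd_ne (n : ℕ) (hne : Even n) (i c : ℤ) : (n : ℂ) + 2 * i + (2 * c + 1) ≠ 0 := by
  obtain ⟨m, rfl⟩ := hne
  have : (2 * (m + i + c) + 1 : ℤ) ≠ 0 := by omega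
  have h2 : ((2 * (m + i + c) + 1 : ℤ) : ℂ) ≠ 0 := by exact_mod_cast this
  intro h
  apply h2
  push_cast at h ⊢
  linear_combination h

def Row2 (n k l : ℕ) (j : ℤ) (f : ℤ → ℂ) : Prop :=
  ∀ i : ℤ, E2 (n + 1 + 2*k) (n + 2*l) (n + 2*i) (n + 2*j) (sg (i - j)) (f (i+1)) (f i) (f (i-1)) = 0

def Row3 (n k l : ℕ) (j : ℤ) (g f : ℤ → ℂ) : Prop :=
  ∀ i : ℤ, E3 (n + 1 + 2*k) (n + 2*l) (n + 2*i) (n + 2*j) (sg (i - j)) (g i)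
    (f (i+1)) (f i) (f (i-1)) = 0

def Row1 (n k l : ℕ) (j : ℤ) (g f : ℤ → ℂ) : Prop :=
  ∀ i : ℤ, E1 (n + 1 + 2*k) (n + 2*l) (n + 2*i) (n + 2*j) (sg (i - j)) (g i)
    (f (i+1)) (f i) (f (i-1)) = 0

def Supp (j : ℤ) (f : ℤ → ℂ) : Prop := ∀ i, i < j → f i = 0

lemma four_ne (n : ℕ) (hne : Even n) (i : ℤ) :
    (((n:ℂ) + 2*i)+3) * (((n:ℂ) + 2*i)+1) * (((n:ℂ) + 2*i)-1) * (((n:ℂ) + 2*i)-3) ≠ 0 := by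
  have h1 := odd_ne n hne i 1
  have h2 := odd_ne n hne i 0
  have h3 := odd_ne n hne i (-1)
  have h4 := odd_ne n hne i (-2)
  refine mul_ne_zero (mul_ne_zero (mul_ne_zero ?_ ?_) ?_) ?_
  · intro h; apply h1; push_cast; linear_combination h
  · intro h; apply h2; push_cast; linear_combination h
  · intro h; apply h3; push_cast; linear_combination h
  · intro h; apply h4; push_cast; linear_combination h

lemma psq_ne (n : ℕ) (hne : Even n) (i : ℤ) : ((n:ℂ) + 2*i)^2 - 1 ≠ 0 := by
  have h := four_ne n hne i
  intro h0
  apply h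
  linear_combination (((n:ℂ) + 2*i)+3) * (((n:ℂ) + 2*i)-3) * h0

lemma pm1_ne (n : ℕ) (hne : Even n) (i : ℤ) : ((n:ℂ) + 2*i) - 1 ≠ 0 := by
  have h := psq_ne n hne i
  intro h0
  apply h
  linear_combination (((n:ℂ) + 2*i)+1) * h0

lemma up_row2 (n k l : ℕ) (hn : 0 < n) (hne : Even n) (j : ℕ) (f g : ℤ → ℂ)
    (h2 : Row2 n k l j f) (h3 : Row3 n k l (j+1) g f) : Row2 n k l (j+1) g := by
  intro i
  have hk := keyA1 (n + 1 + 2*k) (n + 2*l) (n + 2*i) (n + 2*((j+1 : ℤ) : ℂ)) (sg (i - (j+1)))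
    (f (i+1+1)) (f (i+1)) (f i) (f (i-1)) (f (i-1-1)) (g (i+1)) (g i) (g (i-1)) (sg_cases _)
    (by
      have := h2 (i+1)
      rw [show i + 1 - (j:ℤ) = (i - (j+1)) + 1 + 1 by ring, sg_add_one, sg_add_one, neg_neg,
        add_sub_cancel_right] at this
      rw [← this]; push_cast; congr 1 <;> ring)
    (by
      have := h2 i
      rw [show i - (j:ℤ) = (i - (j+1)) + 1 by ring, sg_add_one] at this
      rw [← this]; push_cast; congr 1; ring)
    (by
      have := h2 (i-1)
      rw [show i - 1 - (j:ℤ) = (i - (j+1)) by ring, sub_add_cancel] at this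
      rw [← this]; push_cast; congr 1 <;> ring)
    (by
      have := h3 (i+1)
      rw [show i + 1 - ((j:ℤ)+1) = (i - (j+1)) + 1 by ring, sg_add_one,
        add_sub_cancel_right] at this
      rw [← this]; push_cast; congr 1; ring)
    (by exact h3 i)
    (by
      have := h3 (i-1)
      rw [show i - 1 - ((j:ℤ)+1) = (i - (j+1)) - 1 by ring, sg_sub_one, sub_add_cancel] at this
      rw [← this]; push_cast; congr 1; ring)
  refine (mul_eq_zero.mp hk).resolve_left ?_
  refine mul_ne_zero (mul_ne_zero (by norm_num) (four_ne n hne i)) (mul_ne_zero ?_ ?_)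
  · have := odd_ne n hne (j+1) (-2)
    intro h; apply this; push_cast at *; linear_combination h
  · have : ((n + 2*l + n + 2*j : ℕ) : ℂ) ≠ 0 := by
      rw [Nat.cast_ne_zero]; omega
    intro h; apply this; push_cast at *; linear_combination h

lemma up_row1 (n k l : ℕ) (hn : 0 < n) (hne : Even n) (j : ℕ) (f g : ℤ → ℂ)
    (h2 : Row2 n k l j f) (h3 : Row3 n k l (j+1) g f) : Row1 n k l j f g := by
  intro i
  have hk := keyA2 (n + 1 + 2*k) (n + 2*l) (n + 2*i) (n + 2*((j : ℤ) : ℂ)) (sg (i - j))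
    (f (i+1+1)) (f (i+1)) (f i) (f (i-1)) (f (i-1-1)) (g (i+1)) (g i) (g (i-1)) (sg_cases _)
    (by
      have := h2 (i+1)
      rw [show i + 1 - (j:ℤ) = (i - j) + 1 by ring, sg_add_one,
        add_sub_cancel_right] at this
      rw [← this]; push_cast; congr 1; ring)
    (by exact h2 i)
    (by
      have := h2 (i-1)
      rw [show i - 1 - (j:ℤ) = (i - j) - 1 by ring, sg_sub_one, sub_add_cancel] at this
      rw [← this]; push_cast; congr 1; ring)
    (by
      have := h3 (i+1)
      rw [show i + 1 - ((j:ℤ)+1) = (i - j) by ring,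
        add_sub_cancel_right] at this
      rw [← this]; push_cast; congr 1 <;> ring)
    (by
      have := h3 i
      rw [show i - ((j:ℤ)+1) = (i - j) - 1 by ring, sg_sub_one] at this
      rw [← this]; push_cast; congr 1; ring)
    (by
      have := h3 (i-1)
      rw [show i - 1 - ((j:ℤ)+1) = (i - j) - 1 - 1 by ring, sg_sub_one, sg_sub_one, neg_neg,
        sub_add_cancel] at this
      rw [← this]; push_cast; congr 1 <;> ring)
  refine (mul_eq_zero.mp hk).resolve_left ?_
  refine mul_ne_zero (mul_ne_zero (by norm_num) (four_ne n hne i)) ?_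
  have : ((n + 2*l + n + 2*j : ℕ) : ℂ) ≠ 0 := by
    rw [Nat.cast_ne_zero]; omega
  intro h; apply this; push_cast at *; linear_combination h

lemma down_row2 (n k l : ℕ) (hne : Even n) (j : ℕ) (hj : j < l) (f g : ℤ → ℂ)
    (h2 : Row2 n k l (j+1) f) (h1 : Row1 n k l j g f) : Row2 n k l j g := by
  intro i
  have hk := keyB (n + 1 + 2*k) (n + 2*l) (n + 2*i) (n + 2*((j : ℤ) : ℂ)) (sg (i - j))
    (f (i+1+1)) (f (i+1)) (f i) (f (i-1)) (f (i-1-1)) (g (i+1)) (g i) (g (i-1)) (sg_cases _)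
    (by
      have := h2 (i+1)
      rw [show i + 1 - ((j:ℤ)+1) = (i - j) by ring,
        add_sub_cancel_right] at this
      rw [← this]; push_cast; congr 1 <;> ring)
    (by
      have := h2 i
      rw [show i - ((j:ℤ)+1) = (i - j) - 1 by ring, sg_sub_one] at this
      rw [← this]; push_cast; congr 1; ring)
    (by
      have := h2 (i-1)
      rw [show i - 1 - ((j:ℤ)+1) = (i - j) - 1 - 1 by ring, sg_sub_one, sg_sub_one, neg_neg,
        sub_add_cancel] at this
      rw [← this]; push_cast; congr 1 <;> ring)
    (by
      have := h1 (i+1)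
      rw [show i + 1 - (j:ℤ) = (i - j) + 1 by ring, sg_add_one,
        add_sub_cancel_right] at this
      rw [← this]; push_cast; congr 1; ring)
    (by exact h1 i)
    (by
      have := h1 (i-1)
      rw [show i - 1 - (j:ℤ) = (i - j) - 1 by ring, sg_sub_one, sub_add_cancel] at this
      rw [← this]; push_cast; congr 1; ring)
  refine (mul_eq_zero.mp hk).resolve_left ?_
  refine mul_ne_zero (four_ne n hne i) ?_
  have : ((j : ℂ) - l) ≠ 0 := by
    rw [sub_ne_zero]; exact_mod_cast hj.ne
  intro h; apply this; push_cast at *; linear_combination h / 2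

/-- build the next row upward -/
lemma up_exists (n k l : ℕ) (hn : 0 < n) (hne : Even n) (j : ℕ) (f : ℤ → ℂ)
    (hs : Supp j f) : ∃ g, Row3 n k l (j+1) g f ∧ Supp (j+1) g := by
  have hM : (((n:ℂ) + 2*((j + 1 : ℤ) : ℂ)) - 3) * (((n:ℂ) + 2*l) + ((n:ℂ) + 2*((j + 1 : ℤ) : ℂ)) - 2) ≠ 0 := by
    refine mul_ne_zero ?_ ?_
    · have := odd_ne n hne (j+1) (-2)
      intro h; apply this; push_cast at *; linear_combination h
    · have : ((n + 2*l + n + 2*j : ℕ) : ℂ) ≠ 0 := by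
        rw [Nat.cast_ne_zero]; omega
      intro h; apply this; push_cast at *; linear_combination h
  let c : ℤ → ℂ := fun i => 4 * (((n:ℂ) + 2*i)^2 - 1) *
    ((((n:ℂ) + 2*((j + 1 : ℤ) : ℂ)) - 3) * (((n:ℂ) + 2*l) + ((n:ℂ) + 2*((j + 1 : ℤ) : ℂ)) - 2))
  have hc : ∀ i, c i ≠ 0 := fun i => mul_ne_zero (mul_ne_zero (by norm_num) (psq_ne n hne i)) hM
  refine ⟨fun i => - E3 (n + 1 + 2*k) (n + 2*l) (n + 2*i) (n + 2*((j + 1 : ℤ) : ℂ))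
    (sg (i - (j+1))) 0 (f (i+1)) (f i) (f (i-1)) / c i, ?_, ?_⟩
  · intro i
    have h0 : c i * (- E3 (n + 1 + 2*k) (n + 2*l) (n + 2*i) (n + 2*((j + 1 : ℤ) : ℂ))
      (sg (i - (j+1))) 0 (f (i+1)) (f i) (f (i-1)) / c i) = - E3 (n + 1 + 2*k) (n + 2*l) (n + 2*i)
        (n + 2*((j + 1 : ℤ) : ℂ)) (sg (i - (j+1))) 0 (f (i+1)) (f i) (f (i-1)) := by
      rw [mul_div_cancel₀ _ (hc i)]
    simp only [] 
    generalize (- E3 (n + 1 + 2*k) (n + 2*l) (n + 2*i) (n + 2*((j + 1 : ℤ) : ℂ))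
      (sg (i - (j+1))) 0 (f (i+1)) (f i) (f (i-1)) / c i) = g at *
    simp only [E3, c] at h0 ⊢
    linear_combination h0
  · intro i hi
    have h1 : f (i-1) = 0 := hs _ (by omega)
    have : E3 (n + 1 + 2*k) (n + 2*l) (n + 2*i) (n + 2*((j + 1 : ℤ) : ℂ))
        (sg (i - (j+1))) 0 (f (i+1)) (f i) (f (i-1)) = 0 := by
      rcases lt_trichotomy i (j - 1) with h | h | h
      · rw [h1, hs i (by omega), hs (i+1) (by omega)]; simp [E3]
      · rw [h1, hs i (by omega)]; subst h; simp only [E3]; push_cast; ring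
      · obtain rfl : i = j := by omega
        rw [h1]; simp only [E3]; push_cast; ring
    simp only [this]; simp

/-- build the next row downward -/
lemma down_exists (n k l : ℕ) (hne : Even n) (j : ℕ) (hj : j < l) (hlk : l ≤ k) (f : ℤ → ℂ)
    (hs : Supp (j+1) f) (hf : f (j+1) ≠ 0) : ∃ g, Row1 n k l j g f ∧ Supp j g ∧ g j ≠ 0 := by
  have hM : ((n:ℂ) + 2*((j : ℤ) : ℂ)) - ((n:ℂ) + 2*l) ≠ 0 := by
    have : ((j : ℂ) - l) ≠ 0 := by
      rw [sub_ne_zero]; exact_mod_cast hj.ne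
    intro h; apply this; push_cast at *; linear_combination h / 2
  let c : ℤ → ℂ := fun i => (((n:ℂ) + 2*i)^2 - 1) * (((n:ℂ) + 2*((j : ℤ) : ℂ)) - ((n:ℂ) + 2*l))
  have hc : ∀ i, c i ≠ 0 := fun i => mul_ne_zero (psq_ne n hne i) hM
  refine ⟨fun i => - E1 (n + 1 + 2*k) (n + 2*l) (n + 2*i) (n + 2*((j : ℤ) : ℂ))
    (sg (i - j)) 0 (f (i+1)) (f i) (f (i-1)) / c i, ?_, ?_, ?_⟩
  · intro i
    have h0 : c i * (- E1 (n + 1 + 2*k) (n + 2*l) (n + 2*i) (n + 2*((j : ℤ) : ℂ))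
      (sg (i - j)) 0 (f (i+1)) (f i) (f (i-1)) / c i) = - E1 (n + 1 + 2*k) (n + 2*l) (n + 2*i)
        (n + 2*((j : ℤ) : ℂ)) (sg (i - j)) 0 (f (i+1)) (f i) (f (i-1)) := by
      rw [mul_div_cancel₀ _ (hc i)]
    simp only []
    generalize (- E1 (n + 1 + 2*k) (n + 2*l) (n + 2*i) (n + 2*((j : ℤ) : ℂ))
      (sg (i - j)) 0 (f (i+1)) (f i) (f (i-1)) / c i) = g at *
    simp only [E1, c] at h0 ⊢
    linear_combination h0
  · intro i hi
    have : E1 (n + 1 + 2*k) (n + 2*l) (n + 2*i) (n + 2*((j : ℤ) : ℂ))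
        (sg (i - j)) 0 (f (i+1)) (f i) (f (i-1)) = 0 := by
      rw [hs (i-1) (by omega), hs i (by omega), hs (i+1) (by omega)]; simp [E1]
    simp only [this]; simp
  · refine div_ne_zero ?_ (hc j)
    rw [hs (j-1) (by omega), hs j (by omega)]
    have e1 := pm1_ne n hne j
    have e2 : ((n:ℂ) + 2*((j : ℤ) : ℂ)) - ((n:ℂ) + 1 + 2*k) + 1 ≠ 0 := by
      have : ((j : ℂ) - k) ≠ 0 := by
        rw [sub_ne_zero]; exact_mod_cast (by omega : j ≠ k)
      intro h; apply this; push_cast at *; linear_combination h / 2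
    have := mul_ne_zero (mul_ne_zero (mul_ne_zero e1 e1) e2) hf
    intro h; apply this
    simp only [E1] at h
    linear_combination -h

lemma rec2 (r u : ℤ → ℂ) (a : ℤ) : ∃ f : ℤ → ℂ, (∀ i, i < a → f i = 0) ∧ f a = 1 ∧
    ∀ i, a ≤ i → f (i+1) = r i * f i + u i * f (i-1) := by
  let g : ℕ → ℂ × ℂ := fun m => Nat.rec (0, 1)
    (fun m x => (x.2, r (a+m) * x.2 + u (a+m) * x.1)) m
  have g0 : g 0 = (0, 1) := rfl
  have gs : ∀ m, g (m+1) = ((g m).2, r (a+m) * (g m).2 + u (a+m) * (g m).1) := fun m => rfl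
  refine ⟨fun i => if i < a then 0 else (g (i-a).toNat).2, ?_, ?_, ?_⟩
  · intro i hi; simp [hi]
  · simp [g0]
  · intro i hi
    obtain ⟨m, rfl⟩ : ∃ m : ℕ, i = a + m := ⟨(i-a).toNat, by omega⟩
    have t1 : (a + m + 1 - a).toNat = m + 1 := by omega
    have t0 : (a + m - a).toNat = m := by omega
    simp only [t1, t0, gs, if_neg (show ¬ (a + m + 1 < a) by omega),
      if_neg (show ¬ (a + (m:ℤ) < a) by omega)]
    congr 2
    cases m with
    | zero => simp [g0]
    | succ m =>
      have t2 : (a + ((m+1 : ℕ):ℤ) - 1 - a).toNat = m := by omega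
      rw [if_neg (by omega), t2, gs]

/-- the explicit top row `j = l` -/
lemma row_l (n k l : ℕ) (hlk : l ≤ k) (hkl : Even (k - l)) :
    ∃ f, Row2 n k l l f ∧ Supp l f ∧ f l ≠ 0 := by
  have hkl' : Even ((k:ℤ) - l) := by
    obtain ⟨m, hm⟩ := hkl
    exact ⟨m, by omega⟩
  obtain ⟨f, f1, f2, f3⟩ := rec2 (fun i => if Even (i - l) then
      -((n:ℂ) + i + l) / (i + 1 - l) else
      ((n:ℂ) + i + l) * (n + k + i + 1) / ((i + 1 - l) * (k - i))) (fun _ => 0) l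
  have key : ∀ i : ℤ, (Even (i - l) → ((i:ℂ) - l) * (k + 1 - i) * f i
        = ((n:ℂ) + i + l - 1) * (n + k + i) * f (i - 1)) ∧
      (¬ Even (i - l) → ((i:ℂ) - l) * f i = -((n:ℂ) + i + l - 1) * f (i - 1)) := by
    intro i
    rcases lt_trichotomy i l with h | h | h
    · rw [f1 i h, f1 (i-1) (by omega)]; simp
    · subst h; rw [f1 ((l:ℤ)-1) (by omega)]; simp
    · obtain ⟨d, rfl⟩ : ∃ d, i = d + 1 := ⟨i - 1, by ring⟩
      have hd : (d:ℂ) + 1 - l ≠ 0 := by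
        have : ((d + 1 - l : ℤ) : ℂ) ≠ 0 := by
          rw [Int.cast_ne_zero]; omega
        push_cast at this; exact this
      rw [f3 d (by omega), add_sub_cancel_right]
      constructor
      · intro he
        have hnd : ¬ Even (d - (l:ℤ)) := by
          rw [show d + 1 - (l:ℤ) = (d - l) + 1 by ring, Int.even_add_one] at he
          exact he
        have hkd : (k:ℂ) - d ≠ 0 := by
          have : ((k - d : ℤ) : ℂ) ≠ 0 := by
            rw [Int.cast_ne_zero]
            intro h0
            apply hnd
            rw [show d = (k:ℤ) by omega]; exact hkl'
          push_cast at this; exact this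
        rw [if_neg hnd]
        push_cast
        field_simp
        ring
      · intro he
        have hnd : Even (d - (l:ℤ)) := by
          rw [show d + 1 - (l:ℤ) = (d - l) + 1 by ring, Int.even_add_one, not_not] at he
          exact he
        rw [if_pos hnd]
        push_cast
        field_simp
        ring
  refine ⟨f, ?_, f1, by rw [f2]; exact one_ne_zero⟩
  intro i
  have ki := key i
  have ki1 := key (i+1)
  rw [add_sub_cancel_right] at ki1
  by_cases he : Even (i - (l:ℤ))
  · have he1 : ¬ Even (i + 1 - (l:ℤ)) := by
      rw [show i + 1 - (l:ℤ) = (i - l) + 1 by ring, Int.even_add_one, not_not]; exact he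
    have e0 := ki.1 he
    have e1 := ki1.2 he1
    have hs : sg (i - l) = 1 := he.neg_one_zpow
    rw [hs]
    simp only [E2]
    push_cast at *
    linear_combination (-4*((n:ℂ)+2*i-1)*((i:ℂ)-k)) * e1 - 4*((n:ℂ)+2*i+1) * e0
  · have he1 : Even (i + 1 - (l:ℤ)) := by
      rw [show i + 1 - (l:ℤ) = (i - l) + 1 by ring, Int.even_add_one]; exact he
    have e0 := ki.2 he
    have e1 := ki1.1 he1
    have hs : sg (i - l) = -1 := (Int.not_even_iff_odd.mp he).neg_one_zpow
    rw [hs]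
    simp only [E2]
    push_cast at *
    linear_combination (4*((n:ℂ)+2*i-1)) * e1 + 4*((n:ℂ)+2*i+1)*((n:ℂ)+k+i) * e0

lemma row0_first (n k l : ℕ) (hne : Even n) (hlk : l ≤ k) (hkl : Even (k - l)) :
    ∃ f, Row2 n k l 0 f ∧ Supp 0 f ∧ f 0 ≠ 0 := by
  have : ∀ d j : ℕ, j + d = l → ∃ f, Row2 n k l j f ∧ Supp j f ∧ f j ≠ 0 := by
    intro d
    induction d with
    | zero =>
      intro j hj
      obtain rfl : j = l := by omega
      exact row_l n k j hlk hkl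
    | succ d ih =>
      intro j hj
      obtain ⟨f, hf1, hf2, hf3⟩ := ih (j+1) (by omega)
      push_cast at hf1 hf2 hf3
      obtain ⟨g, hg1, hg2, hg3⟩ := down_exists n k l hne j (by omega) hlk f hf2 hf3
      exact ⟨g, down_row2 n k l hne j (by omega) f g hf1 hg1, hg2, hg3⟩
  simpa using this l 0 (by omega)

lemma row0_second (n k l : ℕ) (hne : Even n) :
    ∃ f, Row2 n k l 0 f ∧ Supp 0 f ∧ f 0 = 0 ∧ f (k+1) ≠ 0 := by
  let c : ℤ → ℂ := fun i => 2 * ((i:ℂ) + 1) * ((n:ℂ) + 2*i - 1) * (2 * (i - k))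
  obtain ⟨f, f1, f2, f3⟩ := rec2
    (fun i => 2 * (-((((n:ℂ) + 2*i)^2-1) * (n + 2*l)) + sg (i - 0) * (n + 2*i) * ((n:ℂ)-1) * (n + 1 + 2*k)) / c i)
    (fun i => (((n:ℂ) + 2*i)+1) * (((n:ℂ) + 2*i)+n-2) * (((n:ℂ) + 2*i)+(n + 1 + 2*k)-1) / c i) (k+1)
  refine ⟨f, ?_, fun i hi => f1 i (by omega), f1 0 (by omega), by rw [f2]; exact one_ne_zero⟩
  intro i
  rcases lt_trichotomy i k with h | h | h
  · rw [f1 i (by omega), f1 (i+1) (by omega), f1 (i-1) (by omega)]; simp [E2]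
  · subst h
    rw [f1 k (by omega), f1 ((k:ℤ)-1) (by omega)]; simp only [E2]; push_cast; ring
  · have hc : c i ≠ 0 := by
      have h1 : (i:ℂ) + 1 ≠ 0 := by
        have : ((i + 1 : ℤ) : ℂ) ≠ 0 := by
          rw [Int.cast_ne_zero]; omega
        push_cast at this; exact this
      have h2 : (i:ℂ) - k ≠ 0 := by
        have : ((i - k : ℤ) : ℂ) ≠ 0 := by
          rw [Int.cast_ne_zero]; omega
        push_cast at this; exact this
      have h3 := pm1_ne n hne i
      exact mul_ne_zero (mul_ne_zero (mul_ne_zero two_ne_zero h1) h3) (mul_ne_zero two_ne_zero h2)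
    have h3 := f3 i (by omega)
    have h4 : c i * f (i+1) = 2 * (-((((n:ℂ) + 2*i)^2-1) * (n + 2*l)) + sg (i - 0) * (n + 2*i) * ((n:ℂ)-1) * (n + 1 + 2*k)) * f i
      + (((n:ℂ) + 2*i)+1) * (((n:ℂ) + 2*i)+n-2) * (((n:ℂ) + 2*i)+(n + 1 + 2*k)-1) * f (i-1) := by
      rw [h3]; field_simp
    simp only [E2, c] at h4 ⊢
    push_cast
    linear_combination -h4

lemma extend (n k l : ℕ) (hn : 0 < n) (hne : Even n) (f : ℤ → ℂ) (h2 : Row2 n k l 0 f)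
    (hs : Supp 0 f) : ∃ S : ℕ → ℤ → ℂ, S 0 = f ∧ ∀ j : ℕ, Row2 n k l j (S j) ∧ Supp j (S j) ∧
      Row3 n k l (j+1) (S (j+1)) (S j) ∧ Row1 n k l j (S j) (S (j+1)) := by
  classical
  have hex : ∀ (j : ℕ) (f : ℤ → ℂ), ∃ g, Supp j f → Row3 n k l (j+1) g f ∧ Supp (j+1) g := by
    intro j f
    by_cases h : Supp j f
    · obtain ⟨g, hg⟩ := up_exists n k l hn hne j f h
      exact ⟨g, fun _ => hg⟩
    · exact ⟨f, fun h' => absurd h' h⟩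
  choose G hG using hex
  let S : ℕ → ℤ → ℂ := fun j => Nat.rec f (fun j x => G j x) j
  have S0 : S 0 = f := rfl
  have Ss : ∀ j, S (j+1) = G j (S j) := fun j => rfl
  have main : ∀ j : ℕ, Row2 n k l j (S j) ∧ Supp j (S j) := by
    intro j
    induction j with
    | zero => exact ⟨by simpa [S0] using h2, by simpa [S0] using hs⟩
    | succ j ih =>
      have := hG j (S j) ih.2
      rw [← Ss] at this
      push_cast
      exact ⟨up_row2 n k l hn hne j _ _ ih.1 this.1, this.2⟩
  refine ⟨S, S0, fun j => ?_⟩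
  have := hG j (S j) (main j).2
  rw [← Ss] at this
  exact ⟨(main j).1, (main j).2, this.1, up_row1 n k l hn hne j _ _ (main j).1 this.1⟩


lemma toV (n k l : ℕ) (hn : 0 < n) (hne : Even n) (f : ℤ → ℂ) (h2 : Row2 n k l 0 f)
    (hs : Supp 0 f) : ∃ s ∈ Vsp n 1 (-((n : ℂ) / 2) - 1 / 2 - k) (-(((n : ℂ) - 1) / 2) - 1 / 2 - l),
      ∀ i : ℕ, s (i, 0) = Complex.I ^ i * f i := by
  obtain ⟨S, S0, hS⟩ := extend n k l hn hne f h2 hs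
  have I0 : Complex.I ≠ 0 := Complex.I_ne_zero
  let s : ℕ × ℕ → ℂ := fun p => Complex.I ^ ((p.1 : ℤ) + p.2) * S p.2 p.1
  have hsd : ∀ i j : ℕ, s (i, j) = Complex.I ^ ((i : ℤ) + j) * S j i := fun i j => rfl
  have hext : ∀ (i : ℤ) (j : ℕ), extS s i j = Complex.I ^ (i + j) * S j i := by
    intro i j
    unfold extS
    split_ifs with h
    · rw [hsd, Int.toNat_natCast, Int.toNat_of_nonneg h.1]
    · rw [(hS j).2.1 i (by omega), mul_zero]
  have up : ∀ z : ℤ, Complex.I ^ (z + 1) = Complex.I ^ z * Complex.I := fun z => zpow_add_one₀ I0 z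
  have dn : ∀ z : ℤ, Complex.I ^ (z - 1) = - (Complex.I ^ z * Complex.I) := by
    intro z; rw [zpow_sub_one₀ I0, Complex.inv_I]; ring
  have hI : Complex.I * Complex.I = -1 := Complex.I_mul_I
  refine ⟨s, ⟨?_, ?_, ?_, ?_⟩, ?_⟩
  · rintro ⟨i, j⟩ h
    rw [hsd, (hS j).2.1 i (by simpa using h), mul_zero]
  · intro i j hij
    have hE := (hS j).2.2.2 i
    have x1 := hext (i+1) (j+1)
    have x0 := hext i (j+1)
    have xm := hext (i-1) (j+1)
    push_cast at x1 x0 xm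
    rw [show ((i:ℤ) + 1 + (j + 1)) = (i + j) + 1 + 1 by ring, up, up] at x1
    rw [show ((i:ℤ) + (j + 1)) = (i + j) + 1 by ring, up] at x0
    rw [show ((i:ℤ) - 1 + (j + 1)) = (i + j) by ring] at xm
    rw [x1, x0, xm, hsd]
    have hsg : (-1 : ℂ) ^ (i - j + 1) = - sg ((i:ℤ) - j) := by
      rw [pow_succ, ← Nat.cast_sub hij, sg, zpow_natCast]; ring
    rw [hsg]
    simp only [E1] at hE
    push_cast at hE
    generalize Complex.I ^ ((i:ℤ) + j) = u at *
    generalize sg ((i:ℤ) - j) = σ at *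
    generalize S (j+1) ((i:ℤ)+1) = t1 at *
    generalize S (j+1) ((i:ℤ)-1) = tm at *
    generalize S (j+1) (i:ℤ) = t0 at *
    generalize S j (i:ℤ) = t at *
    generalize Complex.I = I at *
    linear_combination (u/2) * hE
      - (((n : ℂ) + 2 * i - 1) * ((n : ℂ) + 2 * j - 1) * (i - k) * u * t1
        + σ * ((n : ℂ) + 2 * j - 1) * (n + 1 + 2 * k) * u * t0) * hI
  · intro i j hij
    have hE := (hS j).1 i
    have x1 := hext (i+1) j
    have xm := hext (i-1) j
    rw [show ((i:ℤ) + 1 + j) = (i + j) + 1 by ring, up] at x1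
    rw [show ((i:ℤ) - 1 + j) = (i + j) - 1 by ring, dn] at xm
    rw [x1, xm, hsd]
    have hsg : (-1 : ℂ) ^ (i - j) = sg ((i:ℤ) - j) := by
      rw [← Nat.cast_sub hij, sg, zpow_natCast]
    rw [hsg]
    simp only [E2] at hE
    push_cast at hE
    generalize Complex.I ^ ((i:ℤ) + j) = u at *
    generalize sg ((i:ℤ) - j) = σ at *
    generalize S j ((i:ℤ)+1) = t1 at *
    generalize S j ((i:ℤ)-1) = tm at *
    generalize S j (i:ℤ) = t at *
    generalize Complex.I = I at *
    linear_combination (u/4) * hE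
      + (((i:ℂ) - j + 1) * ((n : ℂ) + 2 * i - 1) * (i - k) * u * t1
        - ((n : ℂ) + 2 * i + 1) * ((n : ℂ) + i + j - 1) * (n + k + i) * u * tm) * hI
  · intro i j h1 hij
    obtain ⟨j, rfl⟩ : ∃ m, j = m + 1 := ⟨j - 1, by omega⟩
    have hE := (hS j).2.2.1 i
    have x1 := hext (i+1) j
    have x0 := hext i j
    have xm := hext (i-1) j
    rw [show ((i:ℤ) + 1 + j) = (i + (j+1 : ℕ)) by push_cast; ring] at x1
    rw [show ((i:ℤ) + j) = (i + (j+1 : ℕ)) - 1 by push_cast; ring, dn] at x0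
    rw [show ((i:ℤ) - 1 + j) = (i + (j+1 : ℕ)) - 1 - 1 by push_cast; ring, dn, dn] at xm
    rw [show (((j+1 : ℕ) : ℤ) - 1) = j by push_cast; ring]
    rw [x1, x0, xm, hsd]
    have hsg : (-1 : ℂ) ^ (i - (j+1) + 1) = - sg ((i:ℤ) - (j + 1)) := by
      rw [pow_succ, ← Nat.cast_succ, ← Nat.cast_sub hij, sg, zpow_natCast]; ring
    rw [hsg]
    simp only [E3] at hE
    push_cast at hE ⊢
    generalize Complex.I ^ ((i:ℤ) + (j + 1)) = u at *
    generalize sg ((i:ℤ) - (j + 1)) = σ at *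
    generalize S j ((i:ℤ)+1) = t1 at *
    generalize S j ((i:ℤ)-1) = tm at *
    generalize S j (i:ℤ) = t0 at *
    generalize S (j+1) (i:ℤ) = t at *
    generalize Complex.I = I at *
    linear_combination (-u/8) * hE
      + (σ * ((i:ℂ) - (j+1) + 1) * ((n : ℂ) + i + (j+1) - 1) * (n + 1 + 2 * k) * u * t0
        + ((n : ℂ) + 2 * i + 1) * ((n : ℂ) + i + (j+1) - 2) * ((n : ℂ) + i + (j+1) - 1) *
          (n + k + i) * u * tm) * hI
  · intro i
    rw [hsd, S0]; simp

lemma inj (n k l : ℕ) (hn : 0 < n) (hne : Even n) (s : ℕ × ℕ → ℂ)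
    (h : s ∈ Vsp n 1 (-((n : ℂ) / 2) - 1 / 2 - k) (-(((n : ℂ) - 1) / 2) - 1 / 2 - l))
    (h0 : s (0, 0) = 0) (hk : s (k+1, 0) = 0) : s = 0 := by
  obtain ⟨ha, -, hc, hd⟩ := h
  have hx : ∀ i j : ℕ, j ≤ i → extS s i j = s (i, j) := by
    intro i j hij
    unfold extS
    rw [if_pos (by omega)]; simp
  have row0 : ∀ i, s (i, 0) = 0 := by
    intro i
    induction i using Nat.strong_induction_on with
    | _ i ih =>
      rcases Nat.eq_zero_or_pos i with rfl | hi
      · exact h0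
      obtain ⟨m, rfl⟩ : ∃ m, i = m + 1 := ⟨i - 1, by omega⟩
      by_cases hm : m = k
      · rw [hm]; exact hk
      have e := hc m 0 (Nat.zero_le _)
      have t1 : extS s ((m:ℤ)+1) ((0:ℕ):ℤ) = s (m+1, 0) := by
        have := hx (m+1) 0 (Nat.zero_le _)
        push_cast at this ⊢; exact this
      have tm : extS s ((m:ℤ)-1) ((0:ℕ):ℤ) = 0 := by
        rcases Nat.eq_zero_or_pos m with rfl | hm'
        · unfold extS; rw [if_neg (by omega)]
        · obtain ⟨r, rfl⟩ : ∃ r, m = r + 1 := ⟨m - 1, by omega⟩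
          have := hx r 0 (Nat.zero_le _)
          rw [show (((r + 1 : ℕ):ℤ) - 1) = r by push_cast; ring, this]
          exact ih r (by omega)
      rw [t1, tm, ih m (by omega)] at e
      have h1 : (m:ℂ) + 1 ≠ 0 := Nat.cast_add_one_ne_zero m
      have h2 : (m:ℂ) - k ≠ 0 := by
        rw [sub_ne_zero]; exact_mod_cast hm
      have h3 := pm1_ne n hne m
      have h4 : (((m:ℂ) + 1) * (((n:ℂ) + 2*((m:ℤ):ℂ)) - 1) * ((m:ℂ) - k) * Complex.I) * s (m+1, 0) = 0 := by
        push_cast at e ⊢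
        linear_combination e
      exact (mul_eq_zero.mp h4).resolve_left
        (mul_ne_zero (mul_ne_zero (mul_ne_zero h1 h3) h2) Complex.I_ne_zero)
  have rows : ∀ j i, s (i, j) = 0 := by
    intro j
    induction j with
    | zero => exact row0
    | succ j ih =>
      intro i
      by_cases hij : j + 1 ≤ i
      · have e := hd i (j+1) (by omega) hij
        have z : ∀ i' : ℤ, extS s i' (((j+1 : ℕ) : ℤ) - 1) = 0 := by
          intro i'
          unfold extS
          split_ifs with hh
          · rw [show ((((j+1 : ℕ) : ℤ) - 1).toNat) = j by omega]; exact ih _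
          · rfl
        rw [z, z, z] at e
        have hM : (((n:ℂ) + 2*((j + 1 : ℤ) : ℂ)) - 3) ≠ 0 := by
          have := odd_ne n hne (j+1) (-2)
          intro h; apply this; push_cast at *; linear_combination h
        have hM2 : ((n + l + j : ℕ) : ℂ) ≠ 0 := by
          rw [Nat.cast_ne_zero]; omega
        have h3 := psq_ne n hne i
        have h4 : ((((n:ℂ) + 2*((i:ℤ):ℂ))^2 - 1) * (((n:ℂ) + 2*((j + 1 : ℤ) : ℂ)) - 3) *
            ((n + l + j : ℕ) : ℂ)) * s (i, j+1) = 0 := by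
          push_cast at e ⊢
          linear_combination -e
        exact (mul_eq_zero.mp h4).resolve_left (mul_ne_zero (mul_ne_zero h3 hM) hM2)
      · exact ha _ (by simp; omega)
  funext ⟨i, j⟩
  exact rows j i

theorem statement13 (n : ℕ) (hn : 0 < n) (hne : Even n) (k l : ℕ) (hlk : l ≤ k)
    (hkl : Even (k - l)) :
    Module.rank ℂ
      ↥(Vsp n 1 (-((n : ℂ) / 2) - 1 / 2 - k) (-(((n : ℂ) - 1) / 2) - 1 / 2 - l)) = 2 := by
  obtain ⟨f, hf1, hf2, hf3⟩ := row0_first n k l hne hlk hkl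
  obtain ⟨g, hg1, hg2, hg3, hg4⟩ := row0_second n k l hne
  obtain ⟨s, hs, hs0⟩ := toV n k l hn hne f hf1 hf2
  obtain ⟨t, ht, ht0⟩ := toV n k l hn hne g hg1 hg2
  have s00 : s (0, 0) ≠ 0 := by
    rw [hs0]; simpa using hf3
  have t00 : t (0, 0) = 0 := by
    rw [ht0]; simpa using hg3
  have t10 : t (k+1, 0) ≠ 0 := by
    rw [ht0]; push_cast
    exact mul_ne_zero (pow_ne_zero _ Complex.I_ne_zero) hg4
  generalize hV : Vsp n 1 (-((n : ℂ) / 2) - 1 / 2 - k) (-(((n : ℂ) - 1) / 2) - 1 / 2 - l) = V at *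
  let Φ : V →ₗ[ℂ] ℂ × ℂ :=
    { toFun := fun v => (v.1 (0, 0), v.1 (k+1, 0))
      map_add' := fun a b => rfl
      map_smul' := fun a b => rfl }
  have hinj : Function.Injective Φ := by
    rw [← LinearMap.ker_eq_bot, LinearMap.ker_eq_bot']
    intro v hv
    have h1 : v.1 (0, 0) = 0 := congrArg Prod.fst hv
    have h2 : v.1 (k+1, 0) = 0 := congrArg Prod.snd hv
    apply Subtype.ext
    exact inj n k l hn hne v.1 (by rw [hV]; exact v.2) h1 h2
  have hsurj : Function.Surjective Φ := by
    rintro ⟨a, b⟩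
    refine ⟨(a / s (0,0)) • ⟨s, hs⟩ + ((b - a / s (0,0) * s (k+1, 0)) / t (k+1, 0)) • ⟨t, ht⟩, ?_⟩
    apply Prod.ext
    · change a / s (0,0) * s (0,0) + (b - a / s (0,0) * s (k+1, 0)) / t (k+1, 0) * t (0,0) = a
      rw [t00]; field_simp; ring
    · change a / s (0,0) * s (k+1,0) + (b - a / s (0,0) * s (k+1, 0)) / t (k+1, 0) * t (k+1,0) = b
      field_simp; ring
  rw [(LinearEquiv.ofBijective Φ ⟨hinj, hsurj⟩).rank_eq]
  rw [rank_prod']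
  simp
  norm_num
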